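/- Gerstenhaber identity: in a pre-operad C, the associator (h,f,g) := (h•f)•g − h•(f•g) of the total composition is graded symmetric in the last two arguments: (h,f,g) = (−1)^{|f||g|}(h,g,f). -/

import Mathlib

/-- A linear pre-operad (composition system) over a commutative ring `K`:
a sequence of `K`-modules `C n` with partial compositions
`∘ᵢ : C m ⊗ C n → C (m+n-1)` (for `0 ≤ i ≤ m-1`), composition relations,
and a unit `𝕀 ∈ C 1`.  Signs `(-1)^{|f||g|}` are written with exponents of the
same parity, e.g. `(m+1)*(n+1) ≡ (m-1)*(n-1) (mod 2)`. -/
structure PreOperad (K : Type*) [CommRing K] where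
  C : ℕ → Type*
  addCommGroup : ∀ n, AddCommGroup (C n)
  module : ∀ n, letI := addCommGroup n; Module K (C n)
  comp : ∀ {m n : ℕ}, C m → ℕ → C n → C (m + n - 1)
  comp_add_left : ∀ {m n : ℕ} (i : ℕ) (g : C n),
    letI := addCommGroup m; letI := addCommGroup (m + n - 1);
    ∀ f₁ f₂ : C m, comp (f₁ + f₂) i g = comp f₁ i g + comp f₂ i g
  comp_add_right : ∀ {m n : ℕ} (f : C m) (i : ℕ),
    letI := addCommGroup n; letI := addCommGroup (m + n - 1);
    ∀ g₁ g₂ : C n, comp f i (g₁ + g₂) = comp f i g₁ + comp f i g₂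
  comp_smul_left : ∀ {m n : ℕ} (a : K) (i : ℕ) (g : C n),
    letI := addCommGroup m; letI := module m;
    letI := addCommGroup (m + n - 1); letI := module (m + n - 1);
    ∀ f : C m, comp (a • f) i g = a • comp f i g
  comp_smul_right : ∀ {m n : ℕ} (f : C m) (i : ℕ) (a : K),
    letI := addCommGroup n; letI := module n;
    letI := addCommGroup (m + n - 1); letI := module (m + n - 1);
    ∀ g : C n, comp f i (a • g) = a • comp f i g
  unit : C 1
  unit_comp : ∀ {n : ℕ} (f : C n),
    (show 1 + n - 1 = n by omega) ▸ comp unit 0 f = f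
  comp_unit : ∀ {n : ℕ} (f : C n) (i : ℕ), i < n → comp f i unit = f
  /-- `(h∘ᵢf)∘ⱼg = (-1)^{|f||g|}(h∘ⱼg)∘_{i+|g|}f` for `0 ≤ j ≤ i-1`. -/
  assoc₁ : ∀ {p m n : ℕ} (h : C p) (f : C m) (g : C n) (i j : ℕ)
    (h₁ : j < i) (h₂ : i < p) (h₃ : 1 ≤ n),
    letI := addCommGroup ((p + n - 1) + m - 1);
    comp (comp h i f) j g =
      (show (p + n - 1) + m - 1 = (p + m - 1) + n - 1 by omega) ▸
        (((-1 : ℤ) ^ ((m + 1) * (n + 1))) • comp (comp h j g) (i + n - 1) f)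
  /-- `(h∘ᵢf)∘ⱼg = h∘ᵢ(f∘_{j-i}g)` for `i ≤ j ≤ i+|f|`. -/
  assoc₂ : ∀ {p m n : ℕ} (h : C p) (f : C m) (g : C n) (i j : ℕ)
    (h₁ : i < p) (h₂ : 1 ≤ m) (h₃ : i ≤ j) (h₄ : j ≤ i + m - 1),
    comp (comp h i f) j g =
      (show p + (m + n - 1) - 1 = (p + m - 1) + n - 1 by omega) ▸
        comp h i (comp f (j - i) g)
  /-- `(h∘ᵢf)∘ⱼg = (-1)^{|f||g|}(h∘_{j-|f|}g)∘ᵢf` for `i+f ≤ j ≤ |h|+|f|`. -/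
  assoc₃ : ∀ {p m n : ℕ} (h : C p) (f : C m) (g : C n) (i j : ℕ)
    (h₁ : i < p) (h₂ : 1 ≤ m) (h₃ : i + m ≤ j) (h₄ : j ≤ (p - 1) + (m - 1)),
    letI := addCommGroup ((p + n - 1) + m - 1);
    comp (comp h i f) j g =
      (show (p + n - 1) + m - 1 = (p + m - 1) + n - 1 by omega) ▸
        (((-1 : ℤ) ^ ((m + 1) * (n + 1))) • comp (comp h (j - (m - 1)) g) i f)

attribute [instance] PreOperad.addCommGroup PreOperad.module

namespace PreOperad

variable {K : Type*} [CommRing K] (o : PreOperad K)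

/-- Transport along an equality of degrees. -/
def nCast {m n : ℕ} (h : m = n) (x : o.C m) : o.C n := h ▸ x

/-- Total composition `f•g := Σ_{i=0}^{|f|} f∘ᵢg`. -/
def tot {m n : ℕ} (f : o.C m) (g : o.C n) : o.C (m + n - 1) :=
  ∑ i ∈ Finset.range m, o.comp f i g

/-- Cup multiplication `f ⌣ g := (-1)^f (μ∘₀f)∘_f g`. -/
def cup (μ : o.C 2) {m n : ℕ} (f : o.C m) (g : o.C n) : o.C (m + n) :=
  ((-1 : ℤ) ^ m) •
    o.nCast (by omega)
      (o.comp (o.nCast (show 2 + m - 1 = m + 1 by omega) (o.comp μ 0 f)) m g)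

/-- Graded commutator `[f,g] := f•g - (-1)^{|f||g|} g•f`. -/
def bracket {m n : ℕ} (f : o.C m) (g : o.C n) : o.C (m + n - 1) :=
  o.tot f g - ((-1 : ℤ) ^ ((m + 1) * (n + 1))) • o.nCast (by omega) (o.tot g f)

/-- Gerstenhaber tribraces `{h,f,g} := Σ_{i=0}^{|h|-1} Σ_{j=i+f}^{|f|+|h|} (h∘ᵢf)∘ⱼg`. -/
def tribrace {p m n : ℕ} (h : o.C p) (f : o.C m) (g : o.C n) :
    o.C ((p + m - 1) + n - 1) :=
  ∑ i ∈ Finset.range (p - 1), ∑ j ∈ Finset.Icc (i + m) ((m - 1) + (p - 1)),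
    o.comp (o.comp h i f) j g

/-- Tetrabraces `{h,f,g,b}`. -/
def tetrabrace {p m n q : ℕ} (h : o.C p) (f : o.C m) (g : o.C n) (b : o.C q) :
    o.C (((p + m - 1) + n - 1) + q - 1) :=
  ∑ i ∈ Finset.range (p - 2), ∑ j ∈ Finset.Icc (i + m) ((p - 1) + (m - 1) - 1),
    ∑ k ∈ Finset.Icc (j + n) ((p - 1) + (m - 1) + (n - 1)),
      o.comp (o.comp (o.comp h i f) j g) k b

/-- Pre-coboundary operator `δf := -[f,μ] = -(f•μ - (-1)^{|f|} μ•f)`. -/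
def delta (μ : o.C 2) {m : ℕ} (f : o.C m) : o.C (m + 1) :=
  -(o.tot f μ) + ((-1 : ℤ) ^ (m + 1)) • o.nCast (by omega) (o.tot μ f)

end PreOperad

namespace PreOperad
variable {K : Type*} [CommRing K] (o : PreOperad K)

theorem nCast_add {m n : ℕ} (e : m = n) (x y : o.C m) :
    o.nCast e (x + y) = o.nCast e x + o.nCast e y := by
  subst e; rfl

theorem nCast_zsmul {m n : ℕ} (e : m = n) (a : ℤ) (x : o.C m) :
    o.nCast e (a • x) = a • o.nCast e x := by
  subst e; rfl

theorem nCast_sum {ι : Type*} {m n : ℕ} (e : m = n) (s : Finset ι) (x : ι → o.C m) :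
    o.nCast e (∑ i ∈ s, x i) = ∑ i ∈ s, o.nCast e (x i) := by
  subst e; rfl

theorem nCast_nCast {l m n : ℕ} (e : l = m) (e' : m = n) (x : o.C l) :
    o.nCast e' (o.nCast e x) = o.nCast (e.trans e') x := by
  subst e e'; rfl

theorem nCast_self {m : ℕ} (e : m = m) (x : o.C m) : o.nCast e x = x := rfl

theorem comp_sum_left {ι : Type*} {m n : ℕ} (s : Finset ι) (f : ι → o.C m) (i : ℕ) (g : o.C n) :
    o.comp (∑ k ∈ s, f k) i g = ∑ k ∈ s, o.comp (f k) i g :=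
  map_sum (AddMonoidHom.mk' (fun f => o.comp f i g) (o.comp_add_left i g)) f s

theorem comp_sum_right {ι : Type*} {m n : ℕ} (f : o.C m) (i : ℕ) (s : Finset ι) (g : ι → o.C n) :
    o.comp f i (∑ k ∈ s, g k) = ∑ k ∈ s, o.comp f i (g k) :=
  map_sum (AddMonoidHom.mk' (fun g => o.comp f i g) (o.comp_add_right f i)) g s

/-- The part of `(h•f)•g` in which `g` is inserted to the left of `f`. -/
def lowerTribrace {p m n : ℕ} (h : o.C p) (f : o.C m) (g : o.C n) :
    o.C ((p + m - 1) + n - 1) :=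
  ∑ i ∈ Finset.range p, ∑ j ∈ Finset.range i, o.comp (o.comp h i f) j g

/-- The part of `(h•f)•g` in which `g` is inserted to the right of `f`. -/
def upperTribrace {p m n : ℕ} (h : o.C p) (f : o.C m) (g : o.C n) :
    o.C ((p + m - 1) + n - 1) :=
  ∑ i ∈ Finset.range p, ∑ j ∈ Finset.Ico (i + m) (p + m - 1), o.comp (o.comp h i f) j g

theorem tot_tot_left {p m n : ℕ} (hm : 1 ≤ m) (h : o.C p) (f : o.C m) (g : o.C n) :
    o.tot (o.tot h f) g =
      o.lowerTribrace h f g + o.nCast (by omega) (o.tot h (o.tot f g)) +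
        o.upperTribrace h f g := by
  simp only [tot, lowerTribrace, upperTribrace, comp_sum_left, comp_sum_right, nCast_sum]
  rw [Finset.sum_comm, ← Finset.sum_add_distrib, ← Finset.sum_add_distrib]
  refine Finset.sum_congr rfl fun i hi => ?_
  have hi := Finset.mem_range.mp hi
  rw [← Finset.sum_range_add_sum_Ico _ (show i + m ≤ p + m - 1 by omega),
    Finset.sum_range_add]
  congr 2
  refine Finset.sum_congr rfl fun k hk => ?_
  have hk := Finset.mem_range.mp hk
  refine (o.assoc₂ h f g i (i + k) hi hm (by omega) (by omega)).trans ?_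
  rw [Nat.add_sub_cancel_left]
  rfl

theorem lowerTribrace_eq {p m n : ℕ} (hp : 1 ≤ p) (hn : 1 ≤ n) (h : o.C p) (f : o.C m) (g : o.C n) :
    o.lowerTribrace h f g =
      ((-1 : ℤ) ^ ((m + 1) * (n + 1))) • o.nCast (by omega) (o.upperTribrace h g f) := by
  simp only [lowerTribrace, upperTribrace, nCast_sum, Finset.smul_sum]
  rw [Finset.sum_sigma', Finset.sum_sigma']
  refine Finset.sum_bij' (fun x _ => ⟨x.2, x.1 + n - 1⟩) (fun x _ => ⟨x.2 + 1 - n, x.1⟩)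
    ?_ ?_ ?_ ?_ ?_
  · rintro ⟨i, j⟩ hx
    simp only [Finset.mem_sigma, Finset.mem_range, Finset.mem_Ico] at hx ⊢
    omega
  · rintro ⟨i, j⟩ hx
    simp only [Finset.mem_sigma, Finset.mem_range, Finset.mem_Ico] at hx ⊢
    omega
  · rintro ⟨i, j⟩ hx
    simp only [Sigma.mk.injEq, heq_eq_eq, and_true]
    omega
  · rintro ⟨i, j⟩ hx
    simp only [Finset.mem_sigma, Finset.mem_range, Finset.mem_Ico] at hx
    simp only [Sigma.mk.injEq, heq_eq_eq, true_and]
    omega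
  · rintro ⟨i, j⟩ hx
    simp only [Finset.mem_sigma, Finset.mem_range] at hx
    rw [← nCast_zsmul]
    exact o.assoc₁ h f g i j hx.2 hx.1 hn

theorem associator_eq {p m n : ℕ} (hm : 1 ≤ m) (h : o.C p) (f : o.C m) (g : o.C n) :
    o.tot (o.tot h f) g - o.nCast (by omega) (o.tot h (o.tot f g)) =
      o.lowerTribrace h f g + o.upperTribrace h f g := by
  rw [tot_tot_left o hm]
  abel

/-- Gerstenhaber identity: the associator `(h,f,g) := (h•f)•g - h•(f•g)` of the
total composition is graded symmetric in the last two arguments: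
`(h,f,g) = (-1)^{|f||g|}(h,g,f)`. -/
theorem gerstenhaber_identity {p m n : ℕ} (hp : 1 ≤ p) (hm : 1 ≤ m) (hn : 1 ≤ n)
    (h : o.C p) (f : o.C m) (g : o.C n) :
    o.tot (o.tot h f) g - o.nCast (by omega) (o.tot h (o.tot f g)) =
      ((-1 : ℤ) ^ ((m + 1) * (n + 1))) •
        o.nCast (by omega)
          (o.tot (o.tot h g) f - o.nCast (by omega) (o.tot h (o.tot g f))) := by
  rw [associator_eq o hm, associator_eq o hn, lowerTribrace_eq o hp hn h f g,
    lowerTribrace_eq o hp hm h g f, nCast_add, nCast_zsmul, nCast_nCast, nCast_self, smul_add,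
    smul_smul, mul_comm (n + 1), ← mul_pow, neg_one_mul, neg_neg, one_pow, one_smul]
  exact add_comm _ _

end PreOperad
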